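/- Let P be a disjunctive program and M ⊆ σ_P a set of atoms. Then M is an answer set of P if and only if P ∪ ¬M̃ is consistent in intuitionistic logic and P ∪ ¬M̃ ⊢_I a for every a ∈ M. -/

import Mathlib

namespace ASP

/-- Propositional formulas over atoms `α`, built with ∧, ∨, ← and ⊥.
`impl A B` denotes the formula `B ← A` (i.e. `A → B`). -/
inductive PropForm (α : Type) : Type
  | var : α → PropForm α
  | fals : PropForm α
  | conj : PropForm α → PropForm α → PropForm α
  | disj : PropForm α → PropForm α → PropForm α
  | impl : PropForm α → PropForm α → PropForm α
  deriving DecidableEq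

namespace PropForm

variable {α : Type}

/-- `¬F` abbreviates `⊥ ← F`. -/
def neg (A : PropForm α) : PropForm α := impl A fals

/-- `⊤` abbreviates `⊥ ← ⊥`. -/
def top : PropForm α := impl fals fals

/-- The set of atoms occurring in a formula. -/
def atoms : PropForm α → Set α
  | var a => {a}
  | fals => ∅
  | conj A B => atoms A ∪ atoms B
  | disj A B => atoms A ∪ atoms B
  | impl A B => atoms A ∪ atoms B

end PropForm

open PropForm

/-- Hilbert-style derivability for intuitionistic propositional logic,
with an extra set `Ax` of additional axioms. -/
inductive Deriv {α : Type} (Ax : Set (PropForm α)) : PropForm α → Prop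
  | ax {A} : A ∈ Ax → Deriv Ax A
  | k (A B) : Deriv Ax (impl A (impl B A))
  | s (A B C) : Deriv Ax (impl (impl A (impl B C)) (impl (impl A B) (impl A C)))
  | conjIntro (A B) : Deriv Ax (impl A (impl B (conj A B)))
  | conjElimL (A B) : Deriv Ax (impl (conj A B) A)
  | conjElimR (A B) : Deriv Ax (impl (conj A B) B)
  | disjIntroL (A B) : Deriv Ax (impl A (disj A B))
  | disjIntroR (A B) : Deriv Ax (impl B (disj A B))
  | disjElim (A B C) : Deriv Ax (impl (impl A C) (impl (impl B C) (impl (disj A B) C)))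
  | falsElim (A) : Deriv Ax (impl fals A)
  | mp {A B} : Deriv Ax (impl A B) → Deriv Ax A → Deriv Ax B

/-- `F` is a theorem of intuitionistic propositional logic. -/
def IThm {α : Type} (F : PropForm α) : Prop := Deriv ∅ F

/-- `F` is a theorem of classical propositional logic
(intuitionistic logic plus double-negation elimination). -/
def CThm {α : Type} (F : PropForm α) : Prop :=
  Deriv {F | ∃ A, F = impl (neg (neg A)) A} F

/-- Conjunction of a finite list of formulas (empty conjunction is ⊤). -/
def bigConj {α : Type} : List (PropForm α) → PropForm α
  | [] => top
  | [A] => A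
  | A :: L => conj A (bigConj L)

/-- Disjunction of a finite list of formulas (empty disjunction is ⊥). -/
def bigDisj {α : Type} : List (PropForm α) → PropForm α
  | [] => fals
  | [A] => A
  | A :: L => disj A (bigDisj L)

/-- `T ⊢_X F`: the formula `F ← (F₁ ∧ ... ∧ Fₙ)` is a theorem of the logic
whose theorems are `Thm`, for some `F₁, ..., Fₙ ∈ T`. -/
def ProvesFrom {α : Type} (Thm : PropForm α → Prop) (T : Set (PropForm α))
    (F : PropForm α) : Prop :=
  ∃ L : List (PropForm α), (∀ G ∈ L, G ∈ T) ∧ Thm (impl (bigConj L) F)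

/-- `T ⊢_I F`. -/
def IProves {α : Type} (T : Set (PropForm α)) (F : PropForm α) : Prop :=
  ProvesFrom IThm T F

/-- `T ⊢_C F`. -/
def CProves {α : Type} (T : Set (PropForm α)) (F : PropForm α) : Prop :=
  ProvesFrom CThm T F

/-- `T` is consistent in intuitionistic logic. -/
def IConsistent {α : Type} (T : Set (PropForm α)) : Prop := ¬ IProves T fals

/-- `T ⊩_I M`: `T` is consistent and proves (intuitionistically) every atom of `M`. -/
def IProvesAll {α : Type} (T : Set (PropForm α)) (M : Set α) : Prop :=
  IConsistent T ∧ ∀ a ∈ M, IProves T (var a)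

/-- `T ≡_I U`: the two theories prove each other's formulas intuitionistically. -/
def IEquivTh {α : Type} (T U : Set (PropForm α)) : Prop :=
  (∀ F ∈ U, IProves T F) ∧ (∀ F ∈ T, IProves U F)

/-- The signature (set of occurring atoms) of a theory. -/
def sigTh {α : Type} (T : Set (PropForm α)) : Set α := ⋃ F ∈ T, F.atoms

/-- `T` is (literal) complete: for every atom `a` of its signature,
`T ⊢_I a` or `T ⊢_I ¬a`. -/
def IComplete {α : Type} (T : Set (PropForm α)) : Prop :=
  ∀ a ∈ sigTh T, IProves T (var a) ∨ IProves T (neg (var a))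

/-- `{¬a : a ∈ S}`. -/
def negSet {α : Type} (S : Set α) : Set (PropForm α) := (fun a => neg (var a)) '' S

/-- `{¬¬a : a ∈ S}`. -/
def negnegSet {α : Type} (S : Set α) : Set (PropForm α) :=
  (fun a => neg (neg (var a))) '' S

/-- Classical two-valued satisfaction, identifying an interpretation with the
set of atoms it makes true. -/
def sat2 {α : Type} (X : Set α) : PropForm α → Prop
  | .var a => a ∈ X
  | .fals => False
  | .conj A B => sat2 X A ∧ sat2 X B
  | .disj A B => sat2 X A ∨ sat2 X B
  | .impl A B => sat2 X A → sat2 X B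

/-- `X` is a classical model of the theory `T`. -/
def isModel2 {α : Type} (X : Set α) (T : Set (PropForm α)) : Prop := ∀ F ∈ T, sat2 X F

/-- `M` is a minimal (under ⊆) classical model of `T`. -/
def isMinModel {α : Type} (T : Set (PropForm α)) (M : Set α) : Prop :=
  isModel2 M T ∧ ∀ N ⊆ M, isModel2 N T → N = M

/-- Evaluation in the 3-valued Gödel logic G3. -/
def g3 {α : Type} (I : α → Fin 3) : PropForm α → Fin 3
  | .var a => I a
  | .fals => 0
  | .conj A B => min (g3 I A) (g3 I B)
  | .disj A B => max (g3 I A) (g3 I B)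
  | .impl A B => if g3 I A ≤ g3 I B then 2 else g3 I B

/-- Nested formulas: built from atoms, ⊤ and ⊥ using ∧, ∨ and ¬. -/
inductive NF (α : Type) : Type
  | var : α → NF α
  | top : NF α
  | bot : NF α
  | conj : NF α → NF α → NF α
  | disj : NF α → NF α → NF α
  | neg : NF α → NF α
  deriving DecidableEq

namespace NF

variable {α : Type}

/-- Reading a nested formula as a propositional formula
(`⊤ = ⊥ ← ⊥` and `¬F = ⊥ ← F`). -/
def toProp : NF α → PropForm α
  | var a => .var a
  | top => PropForm.top
  | bot => .fals
  | conj A B => .conj (toProp A) (toProp B)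
  | disj A B => .disj (toProp A) (toProp B)
  | neg A => PropForm.neg (toProp A)

/-- Atoms occurring in a nested formula. -/
def atoms : NF α → Set α
  | var a => {a}
  | top => ∅
  | bot => ∅
  | conj A B => atoms A ∪ atoms B
  | disj A B => atoms A ∪ atoms B
  | neg A => atoms A

/-- Satisfaction of a (basic, negation-free) nested formula by a set of atoms. -/
def satB (X : Set α) : NF α → Prop
  | var a => a ∈ X
  | top => True
  | bot => False
  | conj A B => satB X A ∧ satB X B
  | disj A B => satB X A ∨ satB X B
  | neg A => ¬ satB X A

open scoped Classical in
/-- The reduct `F^X`: each maximal subformula `¬G` is replaced by ⊥ if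
`X ⊨ G^X` and by ⊤ otherwise. -/
noncomputable def reduct (X : Set α) : NF α → NF α
  | var a => var a
  | top => top
  | bot => bot
  | conj A B => conj (reduct X A) (reduct X B)
  | disj A B => disj (reduct X A) (reduct X B)
  | neg A => if satB X (reduct X A) then bot else top

end NF

/-- An augmented clause `H ← B` is a pair `(H, B)` of nested formulas. -/
abbrev AugClause (α : Type) := NF α × NF α

/-- The propositional formula `H ← B` of an augmented clause. -/
def clauseToProp {α : Type} (c : AugClause α) : PropForm α :=
  .impl c.2.toProp c.1.toProp

/-- The theory of an augmented program. -/
def progTh {α : Type} (P : List (AugClause α)) : Set (PropForm α) :=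
  {F | ∃ c ∈ P, clauseToProp c = F}

/-- The signature of an augmented program. -/
def progSig {α : Type} (P : List (AugClause α)) : Set α :=
  {a | ∃ c ∈ P, a ∈ c.1.atoms ∪ c.2.atoms}

/-- `X` is closed under the (basic) program `P`: for each clause `H ← B`,
`X ⊨ H` whenever `X ⊨ B`. -/
def closedUnder {α : Type} (X : Set α) (P : List (AugClause α)) : Prop :=
  ∀ c ∈ P, NF.satB X c.2 → NF.satB X c.1

/-- The reduct `P^X` of an augmented program. -/
noncomputable def progReduct {α : Type} (X : Set α) (P : List (AugClause α)) :
    List (AugClause α) :=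
  P.map fun c => (c.1.reduct X, c.2.reduct X)

/-- `M` is an answer set of `P`: `M` is minimal (under ⊆) among the sets of
atoms closed under the reduct `P^M`. -/
def isAnswerSet {α : Type} (P : List (AugClause α)) (M : Set α) : Prop :=
  closedUnder M (progReduct M P) ∧ ∀ N ⊆ M, closedUnder N (progReduct M P) → N = M

/-- `M` is a min-answer set of `P`: both an answer set and a minimal model. -/
def isMinAnswerSet {α : Type} (P : List (AugClause α)) (M : Set α) : Prop :=
  isAnswerSet P M ∧ isMinModel (progTh P) M

/-- A G3 interpretation models an augmented program. -/
def g3ModelsProg {α : Type} (I : α → Fin 3) (P : List (AugClause α)) : Prop :=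
  ∀ c ∈ P, g3 I (clauseToProp c) = 2

/-- A free clause: a list of head literals and a list of body literals,
a literal being an atom `(a, true)` or a negated atom `(a, false)`.
It denotes `h₁ ∨ ... ∨ hₙ ← b₁ ∧ ... ∧ bₘ` (empty head = ⊥, empty body = ⊤). -/
structure FClause (α : Type) where
  head : List (α × Bool)
  body : List (α × Bool)
  deriving DecidableEq

/-- The propositional formula of a literal. -/
def litToProp {α : Type} : α × Bool → PropForm α
  | (a, true) => .var a
  | (a, false) => PropForm.neg (.var a)

/-- The nested formula of a literal. -/
def litToNF {α : Type} : α × Bool → NF α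
  | (a, true) => .var a
  | (a, false) => .neg (.var a)

/-- Disjunction of a list of nested formulas (empty = ⊥). -/
def bigDisjNF {α : Type} : List (NF α) → NF α
  | [] => .bot
  | [A] => A
  | A :: L => .disj A (bigDisjNF L)

/-- Conjunction of a list of nested formulas (empty = ⊤). -/
def bigConjNF {α : Type} : List (NF α) → NF α
  | [] => .top
  | [A] => A
  | A :: L => .conj A (bigConjNF L)

namespace FClause

variable {α : Type}

/-- The propositional formula of a free clause. -/
def toProp (c : FClause α) : PropForm α :=
  .impl (bigConj (c.body.map litToProp)) (bigDisj (c.head.map litToProp))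

/-- A free clause as an augmented clause. -/
def toAug (c : FClause α) : AugClause α :=
  (bigDisjNF (c.head.map litToNF), bigConjNF (c.body.map litToNF))

/-- The atoms of a free clause. -/
def atomsF (c : FClause α) : Set α :=
  {a | (∃ b, (a, b) ∈ c.head) ∨ (∃ b, (a, b) ∈ c.body)}

/-- A general clause: all head literals are positive atoms. -/
def isGeneral (c : FClause α) : Prop := ∀ l ∈ c.head, l.2 = true

/-- A disjunctive clause: a general clause with nonempty head. -/
def isDisjunctive (c : FClause α) : Prop := c.isGeneral ∧ c.head ≠ []

/-- A constraint: a clause with empty head (head ⊥). -/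
def isConstraint (c : FClause α) : Prop := c.head = []

end FClause

/-- The theory of a free program. -/
def fTh {α : Type} (P : List (FClause α)) : Set (PropForm α) :=
  {F | ∃ c ∈ P, c.toProp = F}

/-- The signature of a free program. -/
def fSig {α : Type} (P : List (FClause α)) : Set α :=
  {a | ∃ c ∈ P, a ∈ c.atomsF}

/-- `GenDisj(P)`: each constraint `⊥ ← B` is replaced by `p ← B ∧ ¬p`,
where `p` is a new reserved atom. -/
def genDisj {α : Type} [DecidableEq α] (P : List (FClause α)) (p : α) :
    List (FClause α) :=
  P.map fun c =>
    if c.head = [] then ⟨[(p, true)], c.body ++ [(p, false)]⟩ else c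

/-- The atoms `a` such that `¬a` occurs in the head of some clause of `P`
(the set `S` of the FreeGen transformation), as a list. -/
def headNegs {α : Type} (P : List (FClause α)) : List α :=
  P.flatMap fun c => c.head.filterMap fun l => if l.2 = false then some l.1 else none

open scoped Classical in
/-- Replace the occurrence of `¬a` (for `a ∈ S`) by the positive atom `φ a`. -/
noncomputable def substLit {α : Type} (S : Set α) (φ : α → α) (l : α × Bool) :
    α × Bool :=
  if l.2 = false ∧ l.1 ∈ S then (φ l.1, true) else l

/-- Replace every occurrence of `¬a` (for `a ∈ S`) by `φ a` in a clause. -/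
noncomputable def FClause.subst {α : Type} (S : Set α) (φ : α → α) (c : FClause α) :
    FClause α :=
  ⟨c.head.map (substLit S φ), c.body.map (substLit S φ)⟩

/-- `Δ_S = ⋃_{a ∈ S} {φ(a) ← ¬a, ⊥ ← a ∧ φ(a)}`. -/
def deltaClauses {α : Type} (L : List α) (φ : α → α) : List (FClause α) :=
  L.flatMap fun a => [⟨[(φ a, true)], [(a, false)]⟩, ⟨[], [(a, true), (φ a, true)]⟩]

/-- `FreeGen(P) = P' ∪ Δ_S`. -/
noncomputable def freeGen {α : Type} (P : List (FClause α)) (φ : α → α) :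
    List (FClause α) :=
  P.map (FClause.subst {a | a ∈ headNegs P} φ) ++ deltaClauses (headNegs P) φ

open scoped Classical in
/-- The second reduction `redu2(P; ¬¬M)`: clauses whose body contains a literal
`¬a` with `a ∈ M` are deleted; in constraints, positive body literals `a ∈ M`
are deleted. -/
noncomputable def redu2 {α : Type} [DecidableEq α] (P : List (FClause α))
    (M : Set α) : List (FClause α) :=
  (P.filter fun c => decide (¬ ∃ l ∈ c.body, l.2 = false ∧ l.1 ∈ M)).map
    fun c =>
      if c.head = [] then
        ⟨[], c.body.filter fun l => decide (¬ (l.2 = true ∧ l.1 ∈ M))⟩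
      else c

/-- `P₂` is a conservative extension of `P₁`: `M₁` is an answer set of `P₁`
iff `M₂` is an answer set of `P₂`, where `M₁ = M₂ ∩ σ_{P₁}`. -/
def consExt {α : Type} (P1 P2 : List (AugClause α)) : Prop :=
  (∀ M2 : Set α, isAnswerSet P2 M2 → isAnswerSet P1 (M2 ∩ progSig P1)) ∧
  (∀ M1 : Set α, isAnswerSet P1 M1 →
    ∃ M2 : Set α, isAnswerSet P2 M2 ∧ M1 = M2 ∩ progSig P1)

/-- `P₂` is a strong conservative extension of the user program `P₁` (relative
to the user signature `U`): for every user program `P`, `P₂ ∪ P` is a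
conservative extension of `P₁ ∪ P`. -/
def strongConsExt {α : Type} (P1 P2 : List (AugClause α)) (U : Set α) : Prop :=
  ∀ P : List (AugClause α), progSig P ⊆ U → consExt (P1 ++ P) (P2 ++ P)

mutual
  /-- Negation normal form: push negations inward (no pending negation). -/
  def nnf0 {α : Type} : NF α → NF α
    | .var a => .var a
    | .top => .top
    | .bot => .bot
    | .conj A B => .conj (nnf0 A) (nnf0 B)
    | .disj A B => .disj (nnf0 A) (nnf0 B)
    | .neg A => nnf1 A
  /-- Negation normal form under one pending negation. -/
  def nnf1 {α : Type} : NF α → NF α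
    | .var a => .neg (.var a)
    | .top => .bot
    | .bot => .top
    | .conj A B => .disj (nnf1 A) (nnf1 B)
    | .disj A B => .conj (nnf1 A) (nnf1 B)
    | .neg A => nnf2 A
  /-- Negation normal form under two pending negations. -/
  def nnf2 {α : Type} : NF α → NF α
    | .var a => .neg (.neg (.var a))
    | .top => .top
    | .bot => .bot
    | .conj A B => .conj (nnf2 A) (nnf2 B)
    | .disj A B => .disj (nnf2 A) (nnf2 B)
    | .neg A => nnf1 A
end

/-- Conjunctive normal form (list of disjunction-lists of leaves). -/
def cnfNF {α : Type} : NF α → List (List (NF α))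
  | .conj A B => cnfNF A ++ cnfNF B
  | .disj A B => (cnfNF A).flatMap fun c => (cnfNF B).map fun d => c ++ d
  | F => [[F]]

/-- Disjunctive normal form (list of conjunction-lists of leaves). -/
def dnfNF {α : Type} : NF α → List (List (NF α))
  | .disj A B => dnfNF A ++ dnfNF B
  | .conj A B => (dnfNF A).flatMap fun c => (dnfNF B).map fun d => c ++ d
  | F => [[F]]

/-- Read a leaf as a literal (if it is one). -/
def leafLit {α : Type} : NF α → Option (α × Bool)
  | .var a => some (a, true)
  | .neg (.var a) => some (a, false)
  | _ => none

/-- Read a leaf `¬¬a` as the literal `¬a` to be moved to the other side. -/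
def dnegLit {α : Type} : NF α → Option (α × Bool)
  | .neg (.neg (.var a)) => some (a, false)
  | _ => none

/-- Build a free clause from a head disjunct-list and a body conjunct-list:
doubly negated atoms `¬¬a` in the head become `¬a` in the body and vice versa;
trivial clauses (⊤ in the head or ⊥ in the body) are removed. -/
def procClause {α : Type} [DecidableEq α] (hd bd : List (NF α)) :
    Option (FClause α) :=
  if NF.top ∈ hd ∨ NF.bot ∈ bd then none
  else some ⟨hd.filterMap leafLit ++ bd.filterMap dnegLit,
             bd.filterMap leafLit ++ hd.filterMap dnegLit⟩

/-- `AugFree(P)`: the free program obtained from the augmented program `P` by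
pushing negations inward, taking CNF of heads and DNF of bodies, splitting
conjunctions in heads and disjunctions in bodies into separate clauses, and
eliminating doubly negated atoms. -/
def augFree {α : Type} [DecidableEq α] (P : List (AugClause α)) :
    List (FClause α) :=
  P.flatMap fun c =>
    (cnfNF (nnf0 c.1)).flatMap fun hd =>
      (dnfNF (nnf0 c.2)).filterMap fun bd => procClause hd bd

/-- Positive formulas: no negation (in particular no ⊥) occurs. -/
def IsPositive {α : Type} : PropForm α → Prop
  | .var _ => True
  | .fals => False
  | .conj A B => IsPositive A ∧ IsPositive B
  | .disj A B => IsPositive A ∧ IsPositive B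
  | .impl A B => IsPositive A ∧ IsPositive B

/-- The set 𝐍 of two-negated formulas. -/
inductive IsTwoNeg {α : Type} : PropForm α → Prop
  | atom (a : α) : IsTwoNeg (neg (neg (var a)))
  | dneg {A} : IsTwoNeg A → IsTwoNeg (neg (neg A))
  | conj {A B} : IsTwoNeg A → IsTwoNeg B → IsTwoNeg (PropForm.conj A B)
  | disjL {A} (B) : IsTwoNeg A → IsTwoNeg (PropForm.disj A B)
  | disjR {A} (B) : IsTwoNeg A → IsTwoNeg (PropForm.disj B A)
  | himp {A} (B) : IsTwoNeg A → IsTwoNeg (PropForm.impl B A)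

/-- Satisfaction at the world `N` of the here-and-there model `(N, M)`. -/
def htSat {α : Type} (N M : Set α) : PropForm α → Prop
  | .var a => a ∈ N
  | .fals => False
  | .conj A B => htSat N M A ∧ htSat N M B
  | .disj A B => htSat N M A ∨ htSat N M B
  | .impl A B => (sat2 M A → sat2 M B) ∧ (htSat N M A → htSat N M B)

/-- Satisfaction of the reduct with respect to `M` of a literal by the set of atoms `N`. -/
def litSat {α : Type} (N M : Set α) (l : α × Bool) : Prop :=
  if l.2 = true then l.1 ∈ N else l.1 ∉ M

/-- Satisfaction of the reduct with respect to `M` of a free clause by the set of atoms `N`. -/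
def FClause.redSat {α : Type} (N M : Set α) (c : FClause α) : Prop :=
  (∀ l ∈ c.body, litSat N M l) → ∃ l ∈ c.head, litSat N M l

section Derivability

variable {α : Type} {T U : Set (PropForm α)} {A B C F : PropForm α}

theorem Deriv.cut (h : Deriv T F) (hTU : ∀ G ∈ T, Deriv U G) : Deriv U F := by
  induction h with
  | ax hA => exact hTU _ hA
  | k A B => exact .k A B
  | s A B C => exact .s A B C
  | conjIntro A B => exact .conjIntro A B
  | conjElimL A B => exact .conjElimL A B
  | conjElimR A B => exact .conjElimR A B
  | disjIntroL A B => exact .disjIntroL A B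
  | disjIntroR A B => exact .disjIntroR A B
  | disjElim A B C => exact .disjElim A B C
  | falsElim A => exact .falsElim A
  | mp _ _ ih₁ ih₂ => exact .mp ih₁ ih₂

theorem Deriv.mono (h : Deriv T F) (hTU : T ⊆ U) : Deriv U F :=
  h.cut fun _ hG => .ax (hTU hG)

theorem Deriv.weaken (A : PropForm α) (h : Deriv T F) : Deriv T (impl A F) :=
  .mp (.k _ _) h

theorem Deriv.id (A : PropForm α) : Deriv T (impl A A) :=
  .mp (.mp (.s A (impl A A) A) (.k _ _)) (.k _ _)

theorem Deriv.deduction (h : Deriv (insert A T) F) : Deriv T (impl A F) := by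
  induction h with
  | ax hB =>
    rcases hB with rfl | hB
    · exact .id _
    · exact (Deriv.ax hB).weaken A
  | k B C => exact (Deriv.k B C).weaken A
  | s B C D => exact (Deriv.s B C D).weaken A
  | conjIntro B C => exact (Deriv.conjIntro B C).weaken A
  | conjElimL B C => exact (Deriv.conjElimL B C).weaken A
  | conjElimR B C => exact (Deriv.conjElimR B C).weaken A
  | disjIntroL B C => exact (Deriv.disjIntroL B C).weaken A
  | disjIntroR B C => exact (Deriv.disjIntroR B C).weaken A
  | disjElim B C D => exact (Deriv.disjElim B C D).weaken A
  | falsElim B => exact (Deriv.falsElim B).weaken A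
  | mp _ _ ih₁ ih₂ => exact .mp (.mp (.s _ _ _) ih₁) ih₂

theorem Deriv.exists_list (h : Deriv T F) :
    ∃ L : List (PropForm α), (∀ G ∈ L, G ∈ T) ∧ Deriv {G | G ∈ L} F := by
  induction h with
  | @ax A hA => exact ⟨[A], by simpa using hA, .ax (by simp)⟩
  | k A B => exact ⟨[], by simp, .k A B⟩
  | s A B C => exact ⟨[], by simp, .s A B C⟩
  | conjIntro A B => exact ⟨[], by simp, .conjIntro A B⟩
  | conjElimL A B => exact ⟨[], by simp, .conjElimL A B⟩
  | conjElimR A B => exact ⟨[], by simp, .conjElimR A B⟩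
  | disjIntroL A B => exact ⟨[], by simp, .disjIntroL A B⟩
  | disjIntroR A B => exact ⟨[], by simp, .disjIntroR A B⟩
  | disjElim A B C => exact ⟨[], by simp, .disjElim A B C⟩
  | falsElim A => exact ⟨[], by simp, .falsElim A⟩
  | mp _ _ ih₁ ih₂ =>
    obtain ⟨L₁, hL₁, h₁⟩ := ih₁
    obtain ⟨L₂, hL₂, h₂⟩ := ih₂
    refine ⟨L₁ ++ L₂, fun G hG => ?_, .mp (h₁.mono ?_) (h₂.mono ?_)⟩
    · exact (List.mem_append.1 hG).elim (hL₁ G) (hL₂ G)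
    · exact fun G hG => List.mem_append_left _ hG
    · exact fun G hG => List.mem_append_right _ hG

theorem Deriv.bigConj_intro {L : List (PropForm α)} (h : ∀ G ∈ L, Deriv T G) :
    Deriv T (bigConj L) := by
  induction L with
  | nil => exact .id _
  | cons A L ih =>
    cases L with
    | nil => exact h A (by simp)
    | cons B L =>
      exact .mp (.mp (.conjIntro _ _) (h A (by simp)))
        (ih fun G hG => h G (List.mem_cons_of_mem _ hG))

theorem Deriv.bigConj_elim {L : List (PropForm α)} (h : Deriv T (bigConj L)) :
    ∀ G ∈ L, Deriv T G := by
  induction L with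
  | nil => simp
  | cons A L ih =>
    cases L with
    | nil => simpa [bigConj] using h
    | cons B L =>
      intro G hG
      rcases List.mem_cons.1 hG with rfl | hG
      · exact .mp (.conjElimL _ _) h
      · exact ih (.mp (.conjElimR _ _) h) G hG

theorem Deriv.bigDisj_elim {L : List (PropForm α)} (h : ∀ G ∈ L, Deriv T (impl G C)) :
    Deriv T (impl (bigDisj L) C) := by
  induction L with
  | nil => exact .falsElim _
  | cons A L ih =>
    cases L with
    | nil => exact h A (by simp)
    | cons B L =>
      exact .mp (.mp (.disjElim _ _ _) (h A (by simp)))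
        (ih fun G hG => h G (List.mem_cons_of_mem _ hG))

theorem iProves_iff_deriv : IProves T F ↔ Deriv T F := by
  constructor
  · rintro ⟨L, hL, h⟩
    exact .mp (h.mono (Set.empty_subset _)) (.bigConj_intro fun G hG => .ax (hL G hG))
  · intro h
    obtain ⟨L, hL, h⟩ := h.exists_list
    refine ⟨L, hL, Deriv.deduction (h.cut fun G hG => ?_)⟩
    exact Deriv.bigConj_elim (.ax (Set.mem_insert _ _)) G hG

end Derivability

section HereAndThere

variable {α : Type} {N M : Set α}

theorem sat2_of_htSat (hNM : N ⊆ M) : ∀ {F : PropForm α}, htSat N M F → sat2 M F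
  | .var _, h => hNM h
  | .fals, h => h
  | .conj _ _, h => ⟨sat2_of_htSat hNM h.1, sat2_of_htSat hNM h.2⟩
  | .disj _ _, h => h.imp (sat2_of_htSat hNM) (sat2_of_htSat hNM)
  | .impl _ _, h => h.1

theorem htSat_self (F : PropForm α) : htSat M M F ↔ sat2 M F := by
  induction F <;> simp_all [htSat, sat2]

theorem Deriv.htSat {T : Set (PropForm α)} {F : PropForm α} (h : Deriv T F) (hNM : N ⊆ M)
    (hT : ∀ G ∈ T, htSat N M G) : htSat N M F := by
  have per := fun A : PropForm α => sat2_of_htSat hNM (F := A)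
  induction h with
  | ax hA => exact hT _ hA
  | mp _ _ ih₁ ih₂ => exact ih₁.2 ih₂
  | s A B C =>
    have := per A; have := per B; have := per C
    simp only [ASP.htSat, sat2]; tauto
  | disjElim A B C =>
    have := per A; have := per B; have := per C
    simp only [ASP.htSat, sat2]; tauto
  | falsElim A => simp [ASP.htSat, sat2]
  | k A B | conjIntro A B | conjElimL A B | conjElimR A B | disjIntroL A B | disjIntroR A B =>
    have := per A; have := per B
    simp only [ASP.htSat, sat2]; tauto

theorem htSat_bigConj (L : List (PropForm α)) :
    htSat N M (bigConj L) ↔ ∀ G ∈ L, htSat N M G := by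
  induction L with
  | nil => simp [bigConj, PropForm.top, htSat]
  | cons A L ih => cases L <;> simp_all [bigConj, htSat]

theorem htSat_bigDisj (L : List (PropForm α)) :
    htSat N M (bigDisj L) ↔ ∃ G ∈ L, htSat N M G := by
  induction L with
  | nil => simp [bigDisj, htSat]
  | cons A L ih => cases L <;> simp_all [bigDisj, htSat]

theorem htSat_litToProp (hNM : N ⊆ M) (l : α × Bool) :
    htSat N M (litToProp l) ↔ litSat N M l := by
  obtain ⟨a, _ | _⟩ := l
  · have := @hNM a
    simp only [litToProp, PropForm.neg, htSat, sat2, litSat]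
    grind
  · simp [litToProp, htSat, litSat]

theorem htSat_toProp (hNM : N ⊆ M) (c : FClause α) :
    htSat N M c.toProp ↔ c.redSat M M ∧ c.redSat N M := by
  simp only [FClause.toProp, htSat, FClause.redSat, ← htSat_self, htSat_bigConj, htSat_bigDisj,
    List.mem_map, forall_exists_index, and_imp, forall_apply_eq_imp_iff₂,
    exists_exists_and_eq_and, htSat_litToProp hNM, htSat_litToProp subset_rfl]

end HereAndThere

section Reduct

variable {α : Type} {N M : Set α}

theorem satB_reduct_bigConjNF (L : List (NF α)) :
    NF.satB N ((bigConjNF L).reduct M) ↔ ∀ G ∈ L, NF.satB N (G.reduct M) := by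
  induction L with
  | nil => simp [bigConjNF, NF.reduct, NF.satB]
  | cons A L ih => cases L <;> simp_all [bigConjNF, NF.reduct, NF.satB]

theorem satB_reduct_bigDisjNF (L : List (NF α)) :
    NF.satB N ((bigDisjNF L).reduct M) ↔ ∃ G ∈ L, NF.satB N (G.reduct M) := by
  induction L with
  | nil => simp [bigDisjNF, NF.reduct, NF.satB]
  | cons A L ih => cases L <;> simp_all [bigDisjNF, NF.reduct, NF.satB]

theorem satB_reduct_litToNF (l : α × Bool) :
    NF.satB N ((litToNF l).reduct M) ↔ litSat N M l := by
  obtain ⟨a, _ | _⟩ := l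
  · by_cases ha : a ∈ M <;> simp [litToNF, NF.reduct, NF.satB, litSat, ha]
  · simp [litToNF, NF.reduct, NF.satB, litSat]

theorem closedUnder_progReduct_iff (P : List (FClause α)) :
    closedUnder N (progReduct M (P.map FClause.toAug)) ↔ ∀ c ∈ P, c.redSat N M := by
  simp only [closedUnder, progReduct, FClause.toAug, FClause.redSat, List.mem_map,
    forall_exists_index, and_imp, forall_apply_eq_imp_iff₂, exists_exists_and_eq_and,
    satB_reduct_bigConjNF, satB_reduct_bigDisjNF, satB_reduct_litToNF]

end Reduct

theorem finite_fSig {α : Type} (P : List (FClause α)) : (fSig P).Finite := by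
  refine (P.flatMap fun c => (c.head ++ c.body).map Prod.fst).finite_toSet.subset ?_
  rintro a ⟨c, hc, h⟩
  simp only [FClause.atomsF, Set.mem_ofPred_eq] at h
  simp only [Set.mem_ofPred_eq, List.mem_flatMap, List.mem_map, List.mem_append]
  rcases h with ⟨b, hb⟩ | ⟨b, hb⟩
  · exact ⟨c, hc, _, .inl hb, rfl⟩
  · exact ⟨c, hc, _, .inr hb, rfl⟩

section Program

variable {α : Type} {P : List (FClause α)} {M N : Set α} {T : Set (PropForm α)}

theorem deriv_of_litSat (hT : negSet (fSig P \ M) ⊆ T) (hN : ∀ a ∈ N, Deriv T (var a))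
    {c : FClause α} (hc : c ∈ P) {l : α × Bool} (hl : l ∈ c.body) (h : litSat N M l) :
    Deriv T (litToProp l) := by
  obtain ⟨a, _ | _⟩ := l
  · exact .ax (hT ⟨a, ⟨⟨c, hc, .inr ⟨_, hl⟩⟩, by simpa [litSat] using h⟩, rfl⟩)
  · exact hN a (by simpa [litSat] using h)

/-- A clause whose reduct has its body satisfied by derivable atoms allows reasoning by cases
over the atoms of its head that belong to `M`. -/
theorem deriv_of_clause (hP : fTh P ⊆ T) (hT : negSet (fSig P \ M) ⊆ T)
    (hN : ∀ a ∈ N, Deriv T (var a)) {c : FClause α} (hc : c ∈ P) (hgen : c.isGeneral)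
    (hbody : ∀ l ∈ c.body, litSat N M l) {C : PropForm α}
    (hhead : ∀ a ∈ M, (a, true) ∈ c.head → Deriv T (impl (var a) C)) : Deriv T C := by
  have hB : Deriv T (bigConj (c.body.map litToProp)) := .bigConj_intro <| by
    simpa only [List.forall_mem_map] using fun l hl => deriv_of_litSat hT hN hc hl (hbody l hl)
  refine .mp (.bigDisj_elim ?_) (.mp (.ax (hP ⟨c, hc, rfl⟩)) hB)
  rw [List.forall_mem_map]
  rintro ⟨a, b⟩ hl
  obtain rfl : b = true := hgen _ hl
  by_cases ha : a ∈ M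
  · exact hhead a ha hl
  · have hneg : Deriv T (neg (var a)) := .ax (hT ⟨a, ⟨⟨c, hc, .inl ⟨_, hl⟩⟩, ha⟩, rfl⟩)
    exact .mp (.mp (.s _ _ _) ((Deriv.falsElim C).weaken _)) hneg

theorem deriv_of_isMinimal_closed (hgen : ∀ c ∈ P, c.isGeneral) (hM : M.Finite)
    (hP : fTh P ⊆ T) (hT : negSet (fSig P \ M) ⊆ T)
    (hmin : ∀ N ⊆ M, (∀ c ∈ P, c.redSat N M) → N = M) {a : α} (ha : a ∈ M)
    (hNM : N ⊆ M) (hN : ∀ b ∈ N, Deriv T (var b)) : Deriv T (var a) := by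
  induction hk : (M \ N).ncard using Nat.strong_induction_on generalizing N T with
  | _ k ih =>
  by_cases hcl : ∀ c ∈ P, c.redSat N M
  · exact hN a (hmin N hNM hcl ▸ ha)
  simp only [FClause.redSat, not_forall, not_exists, not_and] at hcl
  obtain ⟨c, hc, hbody, hhead⟩ := hcl
  refine deriv_of_clause hP hT hN hc (hgen c hc) hbody fun h hh hmem => Deriv.deduction ?_
  have hhN : h ∉ N := by simpa [litSat] using hhead _ hmem
  have hins := Set.subset_insert (var h) T
  refine ih _ ?_ (hP.trans hins) (hT.trans hins) (Set.insert_subset hh hNM) ?_ rfl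
  · rw [← hk]
    refine Set.ncard_lt_ncard ?_ (hM.subset Set.sdiff_subset)
    refine ⟨Set.sdiff_subset_sdiff_right (Set.subset_insert _ _), fun hsub => ?_⟩
    exact (hsub ⟨hh, hhN⟩).2 (Set.mem_insert _ _)
  · rintro b (rfl | hb)
    · exact .ax (Set.mem_insert _ _)
    · exact (hN b hb).mono hins

theorem htSat_of_redSat (hNM : N ⊆ M) (hM : ∀ c ∈ P, c.redSat M M)
    (hN : ∀ c ∈ P, c.redSat N M) :
    ∀ G ∈ fTh P ∪ negSet (fSig P \ M), htSat N M G := by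
  rintro _ (⟨c, hc, rfl⟩ | ⟨a, ha, rfl⟩)
  · exact (htSat_toProp hNM c).2 ⟨hM c hc, hN c hc⟩
  · exact (htSat_litToProp hNM (a, false)).2 (by simpa [litSat] using ha.2)

end Program

/-- Pearce: for a disjunctive program `P` and `M ⊆ σ_P`,
`M` is an answer set of `P` iff `P ∪ ¬M̃ ⊩_I M`. -/
theorem pearce_disjunctive {α : Type} (P : List (FClause α))
    (hD : ∀ c ∈ P, c.isDisjunctive) (M : Set α) (hM : M ⊆ fSig P) :
    isAnswerSet (P.map FClause.toAug) M ↔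
      IProvesAll (fTh P ∪ negSet (fSig P \ M)) M := by
  have hgen : ∀ c ∈ P, c.isGeneral := fun c hc => (hD c hc).1
  simp only [isAnswerSet, closedUnder_progReduct_iff, IProvesAll, IConsistent, iProves_iff_deriv]
  constructor
  · rintro ⟨hcl, hmin⟩
    refine ⟨fun h => h.htSat subset_rfl (htSat_of_redSat subset_rfl hcl hcl), fun a ha => ?_⟩
    exact deriv_of_isMinimal_closed hgen ((finite_fSig P).subset hM) Set.subset_union_left
      Set.subset_union_right hmin ha (Set.empty_subset M) (by simp)
  · rintro ⟨hcon, hder⟩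
    have hcl : ∀ c ∈ P, c.redSat M M := by
      intro c hc hbody
      by_contra! hhead
      refine hcon (deriv_of_clause Set.subset_union_left Set.subset_union_right hder hc
        (hgen c hc) hbody fun a ha hmem => ?_)
      exact absurd (by simpa [litSat] using ha) (hhead _ hmem)
    refine ⟨hcl, fun N hNM hN => hNM.antisymm fun a ha => ?_⟩
    exact (hder a ha).htSat hNM (htSat_of_redSat hNM hcl hN)

end ASP
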